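/- Suppose the decision-theoretic kernel p(W_V | F_A) obeys distributional consistency and the augmented DAG local Markov property for 𝒢*. Let B ⊆ A and let b ∈ 𝔛_B be a non-idle regime assignment to B (all other regime indicators idle). Then for every i ∈ V and every w* ∈ 𝔛_V such that p(W_{pre(i)} = w*_{pre(i)} | F_B = b) > 0 and p(W_{pa(i)∩B} = b_{pa(i)∩B}, W_{pa(i)∖B} = w*_{pa(i)∖B} | F_A = ∅) > 0: p(W_i = w*_i | W_{pre(i)} = w*_{pre(i)}, F_B = b) = p(W_i = w*_i | W_{pa(i)∩B} = b_{pa(i)∩B}, W_{pa(i)∖B} = w*_{pa(i)∖B}, F_A = ∅). Consequently p(W_V | F_B = b) is identified from the observational distribution p(W_V | F_A = ∅) whenever the observational conditional distributions on the right are well-defined. -/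

import Mathlib

open Finset

namespace CausalPaper

variable {V : Type*} [Fintype V] [LinearOrder V]
variable {𝔛 : V → Type*} [∀ i, Fintype (𝔛 i)]

/-- Probability of the event `E` under the distribution `q` on joint assignments. -/
noncomputable def pr (q : (∀ i, 𝔛 i) → ℝ) (E : (∀ i, 𝔛 i) → Prop) : ℝ :=
  ∑ v : (∀ i, 𝔛 i), Set.indicator (setOf E) q v

/-- Conditional probability of `E` given `F` under `q`. -/
noncomputable def cpr (q : (∀ i, 𝔛 i) → ℝ) (E F : (∀ i, 𝔛 i) → Prop) : ℝ :=
  pr q (fun v => E v ∧ F v) / pr q F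

/-- `q` is a probability distribution on joint assignments. -/
def IsProb (q : (∀ i, 𝔛 i) → ℝ) : Prop :=
  (∀ v, 0 ≤ q v) ∧ (∑ v : (∀ i, 𝔛 i), q v) = 1

/-- `v` agrees with `s` on the coordinates in `S`. -/
def agree (S : Finset V) (s v : ∀ i, 𝔛 i) : Prop :=
  ∀ i ∈ S, v i = s i

/-- The intervention/regime that sets the variables in `B` according to `b`
(and is idle elsewhere). -/
def setOn (B : Finset V) (b : ∀ i, 𝔛 i) : ∀ i, Option (𝔛 i) :=
  fun i => if i ∈ B then some (b i) else none

/-- The support of the partial intervention/regime `f` is contained in `A`. -/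
def suppIn (f : ∀ i, Option (𝔛 i)) (A : Finset V) : Prop :=
  ∀ i, f i ≠ none → i ∈ A

/-- Distributional consistency. -/
def DistConsistent (A : Finset V) (P : (∀ i, Option (𝔛 i)) → (∀ i, 𝔛 i) → ℝ) : Prop :=
  ∀ i ∈ A, ∀ C : Finset V, C ⊆ A \ {i} →
    ∀ (y : ∀ j, 𝔛 j) (b : 𝔛 i) (c : ∀ j, 𝔛 j),
      pr (P (Function.update (setOn C c) i (some b)))
          (fun v => agree (univ \ {i}) y v ∧ v i = b)
        = pr (P (setOn C c)) (fun v => agree (univ \ {i}) y v ∧ v i = b)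

/-- The predecessors of `i` under the total order on `V`. -/
def pre (i : V) : Finset V := univ.filter (fun j => j < i)

/-- The (SWIG / augmented-DAG) ordered local Markov property: under the regime
intervening on all of `A`, the conditional distribution of `X_i` given its
predecessors is a function only of `a` on `pa i ∩ A` and of `w` on `pa i \ A`. -/
def AugmentedLocalMarkov (A : Finset V) (pa : V → Finset V)
    (P : (∀ i, Option (𝔛 i)) → (∀ i, 𝔛 i) → ℝ) : Prop :=
  ∀ (i : V) (a a' w w' : ∀ j, 𝔛 j) (x : 𝔛 i),
    0 < pr (P (setOn A a)) (agree (pre i) w) →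
    0 < pr (P (setOn A a')) (agree (pre i) w') →
    (∀ j ∈ pa i ∩ A, a j = a' j) →
    (∀ j ∈ pa i \ A, w j = w' j) →
    cpr (P (setOn A a)) (fun v => v i = x) (agree (pre i) w)
      = cpr (P (setOn A a')) (fun v => v i = x) (agree (pre i) w')

/-- The ordinary ordered local Markov property for a single distribution `q`:
the conditional distribution of `X_i` given its predecessors is a function only
of the values of the parents. -/
def OrderedLocalMarkov (pa : V → Finset V) (q : (∀ i, 𝔛 i) → ℝ) : Prop :=
  ∀ (i : V) (w w' : ∀ j, 𝔛 j) (x : 𝔛 i),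
    0 < pr q (agree (pre i) w) →
    0 < pr q (agree (pre i) w') →
    (∀ j ∈ pa i, w j = w' j) →
    cpr q (fun v => v i = x) (agree (pre i) w)
      = cpr q (fun v => v i = x) (agree (pre i) w')
open Classical in
theorem pr_eq_sum_ite (q : (∀ i, 𝔛 i) → ℝ) (E : (∀ i, 𝔛 i) → Prop) :
    pr q E = ∑ v, if E v then q v else 0 := by
  refine sum_congr rfl fun v _ => ?_
  rw [Set.indicator_apply]
  congr

theorem pr_nonneg {q : (∀ i, 𝔛 i) → ℝ} (hq : ∀ v, 0 ≤ q v) (E : (∀ i, 𝔛 i) → Prop) :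
    0 ≤ pr q E :=
  sum_nonneg fun v _ => Set.indicator_nonneg (fun x _ => hq x) v

theorem pr_mono {q : (∀ i, 𝔛 i) → ℝ} (hq : ∀ v, 0 ≤ q v) {E F : (∀ i, 𝔛 i) → Prop}
    (h : ∀ v, E v → F v) : pr q E ≤ pr q F :=
  sum_le_sum fun v _ => Set.indicator_le_indicator_of_subset h hq v

theorem pr_congr {q q' : (∀ i, 𝔛 i) → ℝ} {E : (∀ i, 𝔛 i) → Prop}
    (h : ∀ v, E v → q v = q' v) : pr q E = pr q' E := by
  rw [pr_eq_sum_ite, pr_eq_sum_ite]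
  refine sum_congr rfl fun v _ => ?_
  split_ifs with hv
  · exact h v hv
  · rfl

theorem pr_eq_of_forall_iff (q : (∀ i, 𝔛 i) → ℝ) {E : (∀ i, 𝔛 i) → Prop} (w : ∀ i, 𝔛 i)
    (h : ∀ v, E v ↔ v = w) : pr q E = q w := by
  rw [pr_eq_sum_ite, sum_eq_single w (fun v _ hv => if_neg (mt (h v).1 hv))
    fun hw => absurd (mem_univ w) hw, if_pos ((h w).2 rfl)]

theorem pr_agree_univ (q : (∀ i, 𝔛 i) → ℝ) (w : ∀ i, 𝔛 i) : pr q (agree univ w) = q w :=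
  pr_eq_of_forall_iff q w fun v => by simp [agree, funext_iff]

theorem pr_agree_empty {q : (∀ i, 𝔛 i) → ℝ} (hq : IsProb q) (w : ∀ i, 𝔛 i) :
    pr q (agree ∅ w) = 1 := by
  simp [pr_eq_sum_ite, agree, hq.2]

theorem agree_insert (S : Finset V) (i : V) (w v : ∀ i, 𝔛 i) :
    agree (insert i S) w v ↔ v i = w i ∧ agree S w v := by
  simp [agree]

/-- The chain rule; it holds even if the conditioning event is null. -/
theorem pr_and_eq_cpr_mul {q : (∀ i, 𝔛 i) → ℝ} (hq : ∀ v, 0 ≤ q v)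
    (E F : (∀ i, 𝔛 i) → Prop) : pr q (fun v => E v ∧ F v) = cpr q E F * pr q F := by
  by_cases h : pr q F = 0
  · rw [h, mul_zero]
    exact le_antisymm (h ▸ pr_mono hq fun v hv => hv.2) (pr_nonneg hq _)
  · rw [cpr, div_mul_cancel₀ _ h]

theorem pr_agree_insert {q : (∀ i, 𝔛 i) → ℝ} (hq : ∀ v, 0 ≤ q v) (S : Finset V) (i : V)
    (w : ∀ i, 𝔛 i) :
    pr q (agree (insert i S) w) = cpr q (fun v => v i = w i) (agree S w) * pr q (agree S w) := by
  rw [← pr_and_eq_cpr_mul hq]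
  congr 1
  ext v
  exact agree_insert S i w v

theorem sum_pr_agree_insert_update (q : (∀ i, 𝔛 i) → ℝ) {S : Finset V} {i : V} (hi : i ∉ S)
    (w : ∀ i, 𝔛 i) :
    ∑ x : 𝔛 i, pr q (agree (insert i S) (Function.update w i x)) = pr q (agree S w) := by
  classical
  simp only [pr_eq_sum_ite]
  rw [sum_comm]
  refine sum_congr rfl fun v _ => ?_
  have key : ∀ x, agree (insert i S) (Function.update w i x) v ↔ v i = x ∧ agree S w v := by
    intro x
    rw [agree_insert, Function.update_self]
    refine and_congr_right fun _ => forall₂_congr fun j hj => ?_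
    rw [Function.update_of_ne (ne_of_mem_of_not_mem hj hi)]
  simp only [key]
  by_cases h : agree S w v <;> simp [h]

/-- If the conditional probability of `E` given each positive-probability value of `W_S` compatible
with the `S`-measurable event `F` equals `k`, then `E` has conditional probability `k` given `F`. -/
theorem pr_and_eq_mul_of_cpr_agree_eq {q : (∀ i, 𝔛 i) → ℝ} (hq : ∀ v, 0 ≤ q v) (S : Finset V)
    (E F : (∀ i, 𝔛 i) → Prop) (k : ℝ) (hF : ∀ u v, agree S u v → F u → F v)
    (hk : ∀ v, F v → 0 < pr q (agree S v) → cpr q E (agree S v) = k) :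
    pr q (fun v => E v ∧ F v) = k * pr q F := by
  classical
  rw [pr_eq_sum_ite, pr_eq_sum_ite, mul_sum, ← sum_fiberwise univ (fun v (j : S) => v j),
    ← sum_fiberwise univ (fun v (j : S) => v j) (fun v => k * _)]
  refine sum_congr rfl fun r _ => ?_
  by_cases hr : ∃ v : ∀ i, 𝔛 i, (fun j : S => v j) = r ∧ F v
  · obtain ⟨v, rfl, hv⟩ := hr
    have hfib : ∀ u : ∀ i, 𝔛 i, ((fun j : S => u j) = fun j : S => v j) ↔ agree S v u := by
      intro u
      simp [agree, funext_iff]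
    have hchain : pr q (fun u => E u ∧ agree S v u) = k * pr q (agree S v) := by
      rw [pr_and_eq_cpr_mul hq]
      rcases (pr_nonneg hq (agree S v)).eq_or_lt with h | h
      · rw [← h, mul_zero, mul_zero]
      · rw [hk v hv h]
    rw [pr_eq_sum_ite, pr_eq_sum_ite, mul_sum] at hchain
    simp only [hfib, sum_filter]
    convert hchain using 2 with u _ u _
    · by_cases hu : agree S v u
      · simp [hu, hF v u hu hv]
      · simp [hu]
    · by_cases hu : agree S v u
      · simp [hu, hF v u hu hv]
      · simp [hu]
  · have hnF : ∀ u ∈ univ.filter (fun v : ∀ i, 𝔛 i => (fun j : S => v j) = r), ¬ F u :=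
      fun u hu hFu => hr ⟨u, (mem_filter.1 hu).2, hFu⟩
    rw [sum_eq_zero, sum_eq_zero]
    · intro u hu
      simp [hnF u hu]
    · intro u hu
      simp [hnF u hu]

theorem mem_pre {i j : V} : j ∈ pre i ↔ j < i := by simp [pre]

theorem self_notMem_pre (i : V) : i ∉ pre i := by simp [pre]

theorem isLowerSet_pre (i : V) : IsLowerSet (pre i : Set V) := by
  intro x y hyx hx
  rw [mem_coe, mem_pre] at *
  exact hyx.trans_lt hx

theorem isLowerSet_insert_pre (i : V) : IsLowerSet ((insert i (pre i) : Finset V) : Set V) := by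
  intro x y hyx hx
  simp only [mem_coe, mem_insert, mem_pre, ← le_iff_eq_or_lt] at *
  exact hyx.trans hx

theorem isLowerSet_induction {p : Finset V → Prop} (empty : p ∅)
    (step : ∀ i, p (pre i) → p (insert i (pre i))) (S : Finset V) (hS : IsLowerSet (S : Set V)) :
    p S := by
  induction S using Finset.induction_on_max with
  | empty => exact empty
  | insert i s hlt ih =>
    have hs : s = pre i := by
      ext j
      rw [mem_pre]
      refine ⟨hlt j, fun hj => ?_⟩
      have : j ∈ insert i s := hS hj.le (mem_insert_self i s)
      exact (mem_insert.1 this).resolve_left hj.ne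
    subst hs
    exact step i (ih (isLowerSet_pre i))

theorem isLowerSet_reverse_induction {p : Finset V → Prop} (univ_mem : p univ)
    (step : ∀ i, p (insert i (pre i)) → p (pre i)) (S : Finset V) (hS : IsLowerSet (S : Set V)) :
    p S := by
  have main : ∀ T : Finset V, IsLowerSet (T : Set V) → S ⊆ T → p T → p S := by
    refine isLowerSet_induction ?_ ?_
    · intro h hp
      rwa [subset_empty.1 h]
    · intro i ih hsub hp
      by_cases hi : i ∈ S
      · have : S = insert i (pre i) := by
          refine hsub.antisymm fun j hj => ?_
          rcases mem_insert.1 hj with rfl | hj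
          · exact hi
          · exact hS (mem_pre.1 hj).le hi
        rwa [this]
      · exact ih ((subset_insert_iff_of_notMem hi).1 hsub) (step i hp)
  exact main univ (by simpa using isLowerSet_univ) (subset_univ S) univ_mem

theorem suppIn_setOn {A B : Finset V} (h : B ⊆ A) (b : ∀ j, 𝔛 j) : suppIn (setOn B b) A := by
  intro i hi
  by_contra hA
  exact hi (if_neg fun hB => hA (h hB))

theorem DistConsistent.apply_eq {A : Finset V} {P : (∀ i, Option (𝔛 i)) → (∀ i, 𝔛 i) → ℝ}
    (hDC : DistConsistent A P) {B : Finset V} (hBA : B ⊆ A) (b v : ∀ j, 𝔛 j) :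
    P (setOn B b) v = P (setOn A (B.piecewise b v)) v := by
  have main : ∀ D : Finset V, D ⊆ A \ B →
      P (setOn B b) v = P (setOn (B ∪ D) (B.piecewise b v)) v := by
    intro D
    induction D using Finset.induction_on with
    | empty =>
      intro _
      congr 1
      ext1 j
      by_cases hj : j ∈ B <;> simp [setOn, hj]
    | insert i D hi ih =>
      intro hD
      have hiAB := mem_sdiff.1 (hD (mem_insert_self i D))
      have hDAB : D ⊆ A \ B := (subset_insert i D).trans hD
      rw [ih hDAB]
      have hC : B ∪ D ⊆ A \ {i} := by
        intro j hj
        rw [mem_sdiff, mem_singleton]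
        rcases mem_union.1 hj with h | h
        · exact ⟨hBA h, ne_of_mem_of_not_mem h hiAB.2⟩
        · exact ⟨(mem_sdiff.1 (hDAB h)).1, ne_of_mem_of_not_mem h hi⟩
      have hone : ∀ u : ∀ j, 𝔛 j, agree (univ \ {i}) v u ∧ u i = v i ↔ u = v := by
        intro u
        refine ⟨fun h => funext fun j => ?_, ?_⟩
        · by_cases hj : j = i
          · exact hj ▸ h.2
          · exact h.1 j (by simp [hj])
        · rintro rfl
          exact ⟨fun _ _ => rfl, rfl⟩
      have h := hDC i hiAB.1 (B ∪ D) hC v (v i) (B.piecewise b v)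
      rw [pr_eq_of_forall_iff _ v hone, pr_eq_of_forall_iff _ v hone] at h
      rw [← h]
      congr 1
      ext1 j
      by_cases hj : j = i
      · subst hj
        simp [setOn, hiAB.2]
      · simp [setOn, hj]
  rw [main (A \ B) Subset.rfl, union_sdiff_of_subset hBA]

section Markov

variable {A : Finset V} {pa : V → Finset V} {P : (∀ i, Option (𝔛 i)) → (∀ i, 𝔛 i) → ℝ}

/-- If the law of `W_{pre i}` is the same under two full regimes agreeing on `pre i`, so is the
law of `W_{pre i ∪ {i}}`. -/
theorem AugmentedLocalMarkov.pr_insert_eq_of_pr_eq (hM : AugmentedLocalMarkov A pa P)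
    (hpa : ∀ i, pa i ⊆ pre i) (hP : ∀ f, suppIn f A → IsProb (P f)) {i : V}
    {a a' : ∀ j, 𝔛 j} (w : ∀ j, 𝔛 j) (haa' : ∀ j ∈ pre i, a j = a' j)
    (h : pr (P (setOn A a)) (agree (pre i) w) = pr (P (setOn A a')) (agree (pre i) w)) :
    pr (P (setOn A a)) (agree (insert i (pre i)) w)
      = pr (P (setOn A a')) (agree (insert i (pre i)) w) := by
  have hq := fun a => (hP _ (suppIn_setOn (Subset.refl A) a)).1
  rw [pr_agree_insert (hq a), pr_agree_insert (hq a'), ← h]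
  rcases (pr_nonneg (hq a) (agree (pre i) w)).eq_or_lt with h0 | hpos
  · rw [← h0, mul_zero, mul_zero]
  · rw [hM i a a' w w (w i) hpos (h ▸ hpos) (fun j hj => haa' j (hpa i (mem_inter.1 hj).1))
      fun _ _ => rfl]

/-- Under full regimes, interventions do not affect the past. -/
theorem AugmentedLocalMarkov.pr_agree_eq (hM : AugmentedLocalMarkov A pa P)
    (hpa : ∀ i, pa i ⊆ pre i) (hP : ∀ f, suppIn f A → IsProb (P f)) {S : Finset V}
    (hS : IsLowerSet (S : Set V)) {a a' : ∀ j, 𝔛 j} (w : ∀ j, 𝔛 j)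
    (haa' : ∀ j ∈ S, a j = a' j) :
    pr (P (setOn A a)) (agree S w) = pr (P (setOn A a')) (agree S w) := by
  refine isLowerSet_induction (p := fun S => (∀ j ∈ S, a j = a' j) →
    pr (P (setOn A a)) (agree S w) = pr (P (setOn A a')) (agree S w)) ?_ ?_ S hS haa'
  · intro _
    rw [pr_agree_empty (hP _ (suppIn_setOn (Subset.refl A) a)),
      pr_agree_empty (hP _ (suppIn_setOn (Subset.refl A) a'))]
  · intro i ih h
    have hpre : ∀ j ∈ pre i, a j = a' j := fun j hj => h j (mem_insert_of_mem hj)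
    exact hM.pr_insert_eq_of_pr_eq hpa hP w hpre (ih hpre)

/-- The probability of `W_S = w` for an initial segment `S` under a partial regime is that under
the full regime which in addition sets the remaining targets to `w`. -/
theorem pr_setOn_eq (hM : AugmentedLocalMarkov A pa P) (hDC : DistConsistent A P)
    (hpa : ∀ i, pa i ⊆ pre i) (hP : ∀ f, suppIn f A → IsProb (P f)) {B : Finset V} (hBA : B ⊆ A)
    (b : ∀ j, 𝔛 j) {S : Finset V} (hS : IsLowerSet (S : Set V)) (w : ∀ j, 𝔛 j) :
    pr (P (setOn B b)) (agree S w) = pr (P (setOn A (B.piecewise b w))) (agree S w) := by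
  revert w
  refine isLowerSet_reverse_induction (p := fun S => ∀ w : ∀ j, 𝔛 j,
    pr (P (setOn B b)) (agree S w) = pr (P (setOn A (B.piecewise b w))) (agree S w)) ?_ ?_ S hS
  · intro w
    rw [pr_agree_univ, pr_agree_univ, hDC.apply_eq hBA]
  · intro i ih w
    rw [← sum_pr_agree_insert_update _ (self_notMem_pre i),
      ← sum_pr_agree_insert_update (P (setOn A _)) (self_notMem_pre i)]
    refine sum_congr rfl fun x _ => ?_
    rw [ih]
    have h : ∀ j ∈ pre i,
        B.piecewise b (Function.update w i x) j = B.piecewise b w j := by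
      intro j hj
      simp [Finset.piecewise, (mem_pre.1 hj).ne]
    exact hM.pr_insert_eq_of_pr_eq hpa hP _ h (hM.pr_agree_eq hpa hP (isLowerSet_pre i) _ h)

theorem cpr_setOn_eq (hM : AugmentedLocalMarkov A pa P) (hDC : DistConsistent A P)
    (hpa : ∀ i, pa i ⊆ pre i) (hP : ∀ f, suppIn f A → IsProb (P f)) {B : Finset V} (hBA : B ⊆ A)
    (b : ∀ j, 𝔛 j) (i : V) (w : ∀ j, 𝔛 j) :
    cpr (P (setOn B b)) (fun u => u i = w i) (agree (pre i) w)
      = cpr (P (setOn A (B.piecewise b w))) (fun u => u i = w i) (agree (pre i) w) := by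
  have hins : (fun u : ∀ j, 𝔛 j => u i = w i ∧ agree (pre i) w u) = agree (insert i (pre i)) w :=
    funext fun u => propext (agree_insert _ _ _ _).symm
  rw [cpr, cpr, hins, pr_setOn_eq hM hDC hpa hP hBA b (isLowerSet_insert_pre i),
    pr_setOn_eq hM hDC hpa hP hBA b (isLowerSet_pre i)]

theorem cpr_setOn_eq_cpr_none (hM : AugmentedLocalMarkov A pa P) (hDC : DistConsistent A P)
    (hpa : ∀ i, pa i ⊆ pre i) (hP : ∀ f, suppIn f A → IsProb (P f)) {B : Finset V} (hBA : B ⊆ A)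
    (b : ∀ j, 𝔛 j) (i : V) (w : ∀ j, 𝔛 j) (hpos : 0 < pr (P (setOn B b)) (agree (pre i) w))
    (hpos' : 0 < pr (P (fun _ => none))
      (fun u => agree (pa i ∩ B) b u ∧ agree (pa i \ B) w u)) :
    cpr (P (setOn B b)) (fun u => u i = w i) (agree (pre i) w)
      = cpr (P (fun _ => none)) (fun u => u i = w i)
          (fun u => agree (pa i ∩ B) b u ∧ agree (pa i \ B) w u) := by
  have hnone : (fun _ => none : ∀ j, Option (𝔛 j)) = setOn ∅ b := by ext1 j; simp [setOn]
  rw [hnone] at hpos' ⊢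
  rw [eq_comm, cpr, div_eq_iff hpos'.ne']
  refine pr_and_eq_mul_of_cpr_agree_eq (hP _ (suppIn_setOn (empty_subset A) b)).1 (pre i) _ _ _
    ?_ ?_
  · rintro u v huv ⟨h₁, h₂⟩
    refine ⟨fun j hj => ?_, fun j hj => ?_⟩
    · rw [huv j (hpa i (mem_inter.1 hj).1), h₁ j hj]
    · rw [huv j (hpa i (mem_sdiff.1 hj).1), h₂ j hj]
  · rintro v ⟨h₁, h₂⟩ hv
    have hagree : agree (pre i) (Function.update v i (w i)) = agree (pre i) v := by
      ext u
      refine forall₂_congr fun j hj => ?_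
      rw [Function.update_of_ne (mem_pre.1 hj).ne]
    have h := cpr_setOn_eq hM hDC hpa hP (empty_subset A) b i (Function.update v i (w i))
    have hv' := hv
    rw [← hagree, pr_setOn_eq hM hDC hpa hP (empty_subset A) b (isLowerSet_pre i)] at hv'
    rw [hagree, Function.update_self, piecewise_empty] at h
    rw [hagree, piecewise_empty] at hv'
    rw [h, cpr_setOn_eq hM hDC hpa hP hBA b i w]
    rw [pr_setOn_eq hM hDC hpa hP hBA b (isLowerSet_pre i)] at hpos
    refine hM i _ _ v w (w i) hv' hpos ?_ ?_
    · intro j hj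
      obtain ⟨hj, -⟩ := mem_inter.1 hj
      rw [Function.update_of_ne (mem_pre.1 (hpa i hj)).ne]
      by_cases hB : j ∈ B
      · rw [piecewise_eq_of_mem _ _ _ hB, h₁ j (mem_inter.2 ⟨hj, hB⟩)]
      · rw [piecewise_eq_of_notMem _ _ _ hB, h₂ j (mem_sdiff.2 ⟨hj, hB⟩)]
    · intro j hj
      obtain ⟨hj, hjA⟩ := mem_sdiff.1 hj
      exact h₂ j (mem_sdiff.2 ⟨hj, fun hB => hjA (hBA hB)⟩)

end Markov

/-- Kernel identification under interventions on a subset `B ⊆ A`. -/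
theorem stmt16_kernel_fewer_interventions
    (A : Finset V) (hA : A ⊆ univ)
    (pa : V → Finset V) (hpa : ∀ i, pa i ⊆ pre i)
    (P : (∀ i, Option (𝔛 i)) → (∀ i, 𝔛 i) → ℝ)
    (hP : ∀ f, suppIn f A → IsProb (P f))
    (hDC : DistConsistent A P)
    (hM : AugmentedLocalMarkov A pa P)
    (B : Finset V) (hBA : B ⊆ A) (b : ∀ j, 𝔛 j) :
    (∀ (i : V) (w : ∀ j, 𝔛 j),
      0 < pr (P (setOn B b)) (agree (pre i) w) →
      0 < pr (P (fun _ => none))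
            (fun u => agree (pa i ∩ B) b u ∧ agree (pa i \ B) w u) →
      cpr (P (setOn B b)) (fun u => u i = w i) (agree (pre i) w)
        = cpr (P (fun _ => none)) (fun u => u i = w i)
            (fun u => agree (pa i ∩ B) b u ∧ agree (pa i \ B) w u)) ∧
    (∀ w : ∀ j, 𝔛 j,
      (∀ i : V, 0 < pr (P (fun _ => none))
          (fun u => agree (pa i ∩ B) b u ∧ agree (pa i \ B) w u)) →
      P (setOn B b) w
        = ∏ i : V, cpr (P (fun _ => none)) (fun u => u i = w i)
            (fun u => agree (pa i ∩ B) b u ∧ agree (pa i \ B) w u)) := by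
  have hcond := cpr_setOn_eq_cpr_none hM hDC hpa hP hBA b
  refine ⟨hcond, fun w hw => ?_⟩
  have hprob := hP _ (suppIn_setOn hBA b)
  rw [← pr_agree_univ (P (setOn B b)) w]
  refine isLowerSet_induction (p := fun S => pr (P (setOn B b)) (agree S w)
    = ∏ i ∈ S, cpr (P (fun _ => none)) (fun u => u i = w i)
        (fun u => agree (pa i ∩ B) b u ∧ agree (pa i \ B) w u)) ?_ ?_ univ
    (by simpa using isLowerSet_univ)
  · rw [pr_agree_empty hprob, prod_empty]
  · intro i ih
    rw [pr_agree_insert hprob.1, prod_insert (self_notMem_pre i), ← ih]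
    rcases (pr_nonneg hprob.1 (agree (pre i) w)).eq_or_lt with h0 | hpos
    · rw [← h0, mul_zero, mul_zero]
    · rw [hcond i w hpos (hw i)]

end CausalPaper
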